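/- Define the bilinear map Φ on End(V) ⊗ S(𝔤) by Φ(A⊗a, B⊗b) := AB ⊗ φ(a,b), where φ(a,b) := ½ Σ c^s_{ij} c^t_{kl} X_s X_t (∂^i∂^k a)(∂^j∂^l b) + ⅓ Σ c^t_{ks} c^s_{ji} X_t ((∂^k∂^j a)(∂^i b) + (∂^i a)(∂^k∂^j b)) (repeated indices summed). Then for all 𝒜, ℬ, 𝒞 ∈ End(V) ⊗ S(𝔤), one has {𝒜,{ℬ,𝒞}} − {{𝒜,ℬ},𝒞} + 𝒜·Φ(ℬ,𝒞) − Φ(𝒜ℬ,𝒞) + Φ(𝒜,ℬ𝒞) − Φ(𝒜,ℬ)·𝒞 = 0; that is, P∘P is a Hochschild 3-coboundary, so P is a Poisson bracket on the noncommutative algebra End(V) ⊗ S(𝔤) in the sense of Block–Getzler. -/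

import Mathlib

open TensorProduct MvPolynomial

noncomputable section

/-- The bilinear map `(a, b) ↦ u * D₁ a * D₂ b` on polynomials. -/
def bil {n : ℕ} (u : MvPolynomial (Fin n) ℂ)
    (D₁ D₂ : MvPolynomial (Fin n) ℂ →ₗ[ℂ] MvPolynomial (Fin n) ℂ) :
    MvPolynomial (Fin n) ℂ →ₗ[ℂ] MvPolynomial (Fin n) ℂ →ₗ[ℂ] MvPolynomial (Fin n) ℂ :=
  (((LinearMap.mul ℂ (MvPolynomial (Fin n) ℂ)).comp
      ((LinearMap.mulLeft ℂ u).comp D₁)).compl₂ D₂)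

/-- The Poisson bracket `{a,b} = Σ c^k_{ij} X_k (∂^i a)(∂^j b)` on `S(𝔤)`. -/
def Pb {n : ℕ} (c : Fin n → Fin n → Fin n → ℂ) :
    MvPolynomial (Fin n) ℂ →ₗ[ℂ] MvPolynomial (Fin n) ℂ →ₗ[ℂ] MvPolynomial (Fin n) ℂ :=
  ∑ i, ∑ j, ∑ k, c k i j •
    bil (X k) (pderiv i).toLinearMap (pderiv j).toLinearMap

/-- The noncommutative Poisson bracket on `End V ⊗ S(𝔤)`:
`{A ⊗ a, B ⊗ b} = AB ⊗ {a,b}`. -/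
def Pnc {n : ℕ} (c : Fin n → Fin n → Fin n → ℂ) (V : Type*) [AddCommGroup V] [Module ℂ V] :
    (Module.End ℂ V ⊗[ℂ] MvPolynomial (Fin n) ℂ) →ₗ[ℂ]
      (Module.End ℂ V ⊗[ℂ] MvPolynomial (Fin n) ℂ) →ₗ[ℂ]
        (Module.End ℂ V ⊗[ℂ] MvPolynomial (Fin n) ℂ) :=
  TensorProduct.map₂ (LinearMap.mul ℂ (Module.End ℂ V)) (Pb c)

/-- The bilinear map
`φ(a,b) = ½ Σ c^s_{ij} c^t_{kl} X_s X_t (∂^i∂^k a)(∂^j∂^l b)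
  + ⅓ Σ c^t_{ks} c^s_{ji} X_t ((∂^k∂^j a)(∂^i b) + (∂^i a)(∂^k∂^j b))`. -/
def phiL {n : ℕ} (c : Fin n → Fin n → Fin n → ℂ) :
    MvPolynomial (Fin n) ℂ →ₗ[ℂ] MvPolynomial (Fin n) ℂ →ₗ[ℂ] MvPolynomial (Fin n) ℂ :=
  (2 : ℂ)⁻¹ • (∑ i, ∑ j, ∑ k, ∑ l, ∑ s, ∑ t, (c s i j * c t k l) •
      bil (X s * X t) ((pderiv i).toLinearMap ∘ₗ (pderiv k).toLinearMap)
        ((pderiv j).toLinearMap ∘ₗ (pderiv l).toLinearMap))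
  + (3 : ℂ)⁻¹ • (∑ i, ∑ j, ∑ k, ∑ s, ∑ t, (c t k s * c s j i) •
      (bil (X t) ((pderiv k).toLinearMap ∘ₗ (pderiv j).toLinearMap) (pderiv i).toLinearMap
        + bil (X t) (pderiv i).toLinearMap ((pderiv k).toLinearMap ∘ₗ (pderiv j).toLinearMap)))

/-- The Hochschild 2-cochain `Φ(A ⊗ a, B ⊗ b) = AB ⊗ φ(a,b)` on `End V ⊗ S(𝔤)`. -/
def PhiNc {n : ℕ} (c : Fin n → Fin n → Fin n → ℂ) (V : Type*) [AddCommGroup V] [Module ℂ V] :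
    (Module.End ℂ V ⊗[ℂ] MvPolynomial (Fin n) ℂ) →ₗ[ℂ]
      (Module.End ℂ V ⊗[ℂ] MvPolynomial (Fin n) ℂ) →ₗ[ℂ]
        (Module.End ℂ V ⊗[ℂ] MvPolynomial (Fin n) ℂ) :=
  TensorProduct.map₂ (LinearMap.mul ℂ (Module.End ℂ V)) (phiL c)

/-- The Poisson tensor `π^{ij} = Σ c^k_{ij} X_k`. -/
def poissonTensor {n : ℕ} (c : Fin n → Fin n → Fin n → ℂ) (i j : Fin n) :
    MvPolynomial (Fin n) ℂ :=
  ∑ k, c k i j • X k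

/-- The double bracket `[X_i, [X_j, X_k]]`, as a linear polynomial. -/
def doubleBracket {n : ℕ} (c : Fin n → Fin n → Fin n → ℂ) (i j k : Fin n) :
    MvPolynomial (Fin n) ℂ :=
  ∑ s, c s j k • poissonTensor c i s

section

variable {M : Type*} [AddCommMonoid M] {n : ℕ}

lemma sum_comm_left (f : Fin n → Fin n → Fin n → M) :
    ∑ i, ∑ j, ∑ k, f i j k = ∑ i, ∑ j, ∑ k, f j i k :=
  Finset.sum_comm

lemma sum_comm_right (f : Fin n → Fin n → Fin n → M) :
    ∑ i, ∑ j, ∑ k, f i j k = ∑ i, ∑ j, ∑ k, f i k j :=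
  Finset.sum_congr rfl fun _ _ => Finset.sum_comm

lemma sum_reverse (f : Fin n → Fin n → Fin n → Fin n → M) :
    ∑ i, ∑ j, ∑ k, ∑ l, f i j k l = ∑ i, ∑ j, ∑ k, ∑ l, f l k j i := by
  simp only [← Fintype.sum_prod_type']
  exact Fintype.sum_equiv
    ⟨fun p => (p.2.2.2, p.2.2.1, p.2.1, p.1), fun p => (p.2.2.2, p.2.2.1, p.2.1, p.1),
      fun _ => rfl, fun _ => rfl⟩ _ _ fun _ => rfl

lemma sum_swap_pairs (f : Fin n → Fin n → Fin n → Fin n → M) :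
    ∑ i, ∑ j, ∑ k, ∑ l, f i j k l = ∑ i, ∑ j, ∑ k, ∑ l, f k l i j := by
  simp only [← Fintype.sum_prod_type']
  exact Fintype.sum_equiv
    ⟨fun p => (p.2.2.1, p.2.2.2, p.1, p.2.1), fun p => (p.2.2.1, p.2.2.2, p.1, p.2.1),
      fun _ => rfl, fun _ => rfl⟩ _ _ fun _ => rfl

end

/-- The part `Σ π^{ij} π^{kl} (∂^i∂^k a)(∂^j∂^l b)` of `φ`, up to the factor `½`. -/
def phiQuadratic {n : ℕ} (c : Fin n → Fin n → Fin n → ℂ) (a b : MvPolynomial (Fin n) ℂ) :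
    MvPolynomial (Fin n) ℂ :=
  ∑ i, ∑ j, ∑ k, ∑ l, poissonTensor c i j * poissonTensor c k l *
    (pderiv i (pderiv k a) * pderiv j (pderiv l b))

/-- The part of `φ` with linear coefficients, up to the factor `⅓`. -/
def phiLinear {n : ℕ} (c : Fin n → Fin n → Fin n → ℂ) (a b : MvPolynomial (Fin n) ℂ) :
    MvPolynomial (Fin n) ℂ :=
  ∑ i, ∑ j, ∑ k, doubleBracket c k j i *
    (pderiv k (pderiv j a) * pderiv i b + pderiv i a * pderiv k (pderiv j b))

/-- The part of the coboundary of `φ` with quadratic coefficients. -/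
def coboundaryQuadratic {n : ℕ} (c : Fin n → Fin n → Fin n → ℂ)
    (a b d : MvPolynomial (Fin n) ℂ) : MvPolynomial (Fin n) ℂ :=
  ∑ i, ∑ j, ∑ k, ∑ l, poissonTensor c i j * poissonTensor c k l *
    (pderiv i (pderiv k a) * pderiv j b * pderiv l d -
      pderiv i a * pderiv k b * pderiv j (pderiv l d))

/-- The part of the coboundary of `φ` with linear coefficients. -/
def coboundaryLinear {n : ℕ} (c : Fin n → Fin n → Fin n → ℂ)
    (a b d : MvPolynomial (Fin n) ℂ) : MvPolynomial (Fin n) ℂ :=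
  ∑ i, ∑ k, ∑ l, doubleBracket c k l i * (pderiv i a * pderiv k b * pderiv l d)

section

variable {n : ℕ} (c : Fin n → Fin n → Fin n → ℂ)

lemma pderiv_comm (i j : Fin n) (a : MvPolynomial (Fin n) ℂ) :
    pderiv i (pderiv j a) = pderiv j (pderiv i a) := by
  have h : ⁅(pderiv i : Derivation ℂ (MvPolynomial (Fin n) ℂ) (MvPolynomial (Fin n) ℂ)),
      (pderiv j : Derivation ℂ (MvPolynomial (Fin n) ℂ) (MvPolynomial (Fin n) ℂ))⁆ = 0 := by
    refine MvPolynomial.derivation_ext fun k => ?_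
    rw [Derivation.commutator_apply]
    simp only [pderiv_X, Pi.single_apply]
    split_ifs <;> simp
  have := DFunLike.congr_fun h a
  rwa [Derivation.commutator_apply, Derivation.zero_apply, sub_eq_zero] at this

lemma pderiv_poissonTensor (s i j : Fin n) :
    pderiv s (poissonTensor c i j) = C (c s i j) := by
  simp [poissonTensor, map_sum, pderiv_X, Pi.single_apply, smul_eq_C_mul]

lemma Pb_apply (a b : MvPolynomial (Fin n) ℂ) :
    Pb c a b = ∑ i, ∑ j, poissonTensor c i j * (pderiv i a * pderiv j b) := by
  simp only [Pb, LinearMap.sum_apply, LinearMap.smul_apply, bil, poissonTensor, Finset.sum_mul]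
  simp [mul_assoc]

lemma phiL_apply (a b : MvPolynomial (Fin n) ℂ) :
    phiL c a b = C (2 : ℂ)⁻¹ * phiQuadratic c a b + C (3 : ℂ)⁻¹ * phiLinear c a b := by
  have hbil (u : MvPolynomial (Fin n) ℂ) (D₁ D₂ : MvPolynomial (Fin n) ℂ →ₗ[ℂ] _) :
      bil u D₁ D₂ a b = u * D₁ a * D₂ b := rfl
  simp only [phiL, LinearMap.add_apply, LinearMap.smul_apply, LinearMap.sum_apply, hbil,
    smul_eq_C_mul (R := ℂ), LinearMap.comp_apply, Derivation.coeFn_coe,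
    phiQuadratic, phiLinear]
  congr 2
  · refine Finset.sum_congr rfl fun i _ => Finset.sum_congr rfl fun j _ =>
      Finset.sum_congr rfl fun k _ => Finset.sum_congr rfl fun l _ => ?_
    rw [poissonTensor, poissonTensor, Finset.sum_mul_sum]
    simp only [Finset.sum_mul, smul_eq_C_mul, C_mul]
    refine Finset.sum_congr rfl fun s _ => Finset.sum_congr rfl fun t _ => ?_
    ring
  · refine Finset.sum_congr rfl fun i _ => Finset.sum_congr rfl fun j _ =>
      Finset.sum_congr rfl fun k _ => ?_
    simp only [doubleBracket, poissonTensor, Finset.mul_sum, Finset.sum_mul, smul_eq_C_mul, C_mul]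
    refine Finset.sum_congr rfl fun s _ => Finset.sum_congr rfl fun t _ => ?_
    ring

lemma doubleBracket_skew (hskew : ∀ k i j, c k i j = - c k j i) (i j k : Fin n) :
    doubleBracket c i j k = - doubleBracket c i k j := by
  simp only [doubleBracket, ← Finset.sum_neg_distrib]
  exact Finset.sum_congr rfl fun s _ => by rw [hskew s j k, neg_smul]

lemma doubleBracket_jacobi (hskew : ∀ k i j, c k i j = - c k j i)
    (hjac : ∀ i j l m, (∑ k, (c k i j * c m k l + c k j l * c m k i + c k l i * c m k j)) = 0)
    (i j k : Fin n) :
    doubleBracket c i j k + doubleBracket c j k i + doubleBracket c k i j = 0 := by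
  simp only [doubleBracket, poissonTensor, Finset.smul_sum, ← Finset.sum_add_distrib, smul_smul,
    ← add_smul]
  rw [Finset.sum_comm]
  refine Finset.sum_eq_zero fun m _ => ?_
  rw [← Finset.sum_smul]
  convert zero_smul ℂ _
  rw [← neg_eq_zero, ← hjac i j k m, ← Finset.sum_neg_distrib]
  refine Finset.sum_congr rfl fun s _ => ?_
  rw [hskew m i s, hskew m j s, hskew m k s]
  ring

/-- The expansion of `{a,{b,d}}`. -/
lemma Pb_Pb_right (a b d : MvPolynomial (Fin n) ℂ) :
    Pb c a (Pb c b d) =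
      (∑ i, ∑ k, ∑ l, doubleBracket c i k l * (pderiv i a * pderiv k b * pderiv l d)) +
      ∑ i, ∑ j, ∑ k, ∑ l, poissonTensor c i j * poissonTensor c k l *
        (pderiv i a * (pderiv j (pderiv k b) * pderiv l d + pderiv k b * pderiv j (pderiv l d))) := by
  have hq : (∑ i, ∑ k, ∑ l, doubleBracket c i k l * (pderiv i a * pderiv k b * pderiv l d)) =
      ∑ i, ∑ j, ∑ k, ∑ l, poissonTensor c i j * C (c j k l) *
        (pderiv i a * pderiv k b * pderiv l d) := by
    refine Finset.sum_congr rfl fun i _ => ?_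
    simp only [doubleBracket, Finset.sum_mul]
    rw [Finset.sum_congr rfl fun k _ => Finset.sum_comm, Finset.sum_comm]
    simp only [smul_eq_C_mul, mul_comm (C _)]
  rw [hq, Pb_apply]
  simp only [Pb_apply, map_sum, Derivation.leibniz, pderiv_poissonTensor, smul_eq_mul,
    Finset.mul_sum, ← Finset.sum_add_distrib]
  refine Finset.sum_congr rfl fun i _ => Finset.sum_congr rfl fun j _ =>
    Finset.sum_congr rfl fun k _ => Finset.sum_congr rfl fun l _ => ?_
  ring

lemma poissonTensor_skew (hskew : ∀ k i j, c k i j = - c k j i) (i j : Fin n) :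
    poissonTensor c i j = - poissonTensor c j i := by
  simp only [poissonTensor, ← Finset.sum_neg_distrib, ← neg_smul, ← hskew]

lemma Pb_skew (hskew : ∀ k i j, c k i j = - c k j i) (a b : MvPolynomial (Fin n) ℂ) :
    Pb c a b = - Pb c b a := by
  rw [Pb_apply, Pb_apply, Finset.sum_comm]
  simp only [← Finset.sum_neg_distrib]
  refine Finset.sum_congr rfl fun i _ => Finset.sum_congr rfl fun j _ => ?_
  rw [poissonTensor_skew c hskew]
  ring

lemma Pb_Pb_left (hskew : ∀ k i j, c k i j = - c k j i) (a b d : MvPolynomial (Fin n) ℂ) :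
    Pb c (Pb c a b) d = Pb c d (Pb c b a) := by
  rw [Pb_skew c hskew, Pb_skew c hskew a b, map_neg, neg_neg]

lemma pderiv_mul_eq (i : Fin n) (x y : MvPolynomial (Fin n) ℂ) :
    pderiv i (x * y) = x * pderiv i y + y * pderiv i x := by
  simp [Derivation.leibniz]

lemma pderiv_pderiv_mul (i k : Fin n) (x y : MvPolynomial (Fin n) ℂ) :
    pderiv i (pderiv k (x * y)) =
      x * pderiv i (pderiv k y) + pderiv i x * pderiv k y + pderiv i y * pderiv k x
        + y * pderiv i (pderiv k x) := by
  simp only [pderiv_mul_eq, map_add]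
  ring

lemma phiQuadratic_coboundary (a b d : MvPolynomial (Fin n) ℂ) :
    a * phiQuadratic c b d - phiQuadratic c (a * b) d + phiQuadratic c a (b * d)
      - phiQuadratic c a b * d = 2 * coboundaryQuadratic c a b d := by
  rw [two_mul]
  nth_rw 2 [coboundaryQuadratic]
  rw [sum_swap_pairs]
  simp only [phiQuadratic, coboundaryQuadratic, Finset.mul_sum, Finset.sum_mul,
    ← Finset.sum_add_distrib, ← Finset.sum_sub_distrib]
  refine Finset.sum_congr rfl fun i _ => Finset.sum_congr rfl fun j _ =>
    Finset.sum_congr rfl fun k _ => Finset.sum_congr rfl fun l _ => ?_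
  rw [pderiv_pderiv_mul, pderiv_pderiv_mul, pderiv_comm k i, pderiv_comm l j]
  ring

lemma phiLinear_coboundary (hskew : ∀ k i j, c k i j = - c k j i)
    (hjac : ∀ i j l m, (∑ k, (c k i j * c m k l + c k j l * c m k i + c k l i * c m k j)) = 0)
    (a b d : MvPolynomial (Fin n) ℂ) :
    a * phiLinear c b d - phiLinear c (a * b) d + phiLinear c a (b * d) - phiLinear c a b * d =
      3 * coboundaryLinear c a b d := by
  have expand :
      (∑ i, ∑ k, ∑ l, doubleBracket c k l i * (pderiv i a * pderiv k b * pderiv l d)) +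
      (∑ i, ∑ k, ∑ l, doubleBracket c l k i * (pderiv i a * pderiv k b * pderiv l d)) -
      (∑ i, ∑ k, ∑ l, doubleBracket c i k l * (pderiv i a * pderiv k b * pderiv l d)) -
      (∑ i, ∑ k, ∑ l, doubleBracket c k i l * (pderiv i a * pderiv k b * pderiv l d)) =
      3 * coboundaryLinear c a b d := by
    simp only [coboundaryLinear, Finset.mul_sum, ← Finset.sum_add_distrib, ← Finset.sum_sub_distrib]
    refine Finset.sum_congr rfl fun i _ => Finset.sum_congr rfl fun k _ =>
      Finset.sum_congr rfl fun l _ => ?_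
    linear_combination (-(pderiv i a * pderiv k b * pderiv l d)) *
      (doubleBracket_jacobi c hskew hjac i k l - doubleBracket_skew c hskew l i k
        + doubleBracket_skew c hskew k i l)
  rw [← expand,
    sum_comm_right fun i k l => doubleBracket c k l i * (pderiv i a * pderiv k b * pderiv l d),
    sum_comm_left fun i k l => doubleBracket c i k l * (pderiv i a * pderiv k b * pderiv l d),
    sum_comm_right fun i k l => doubleBracket c k i l * (pderiv k a * pderiv i b * pderiv l d),
    sum_comm_left fun i k l => doubleBracket c l i k * (pderiv l a * pderiv i b * pderiv k d),
    sum_comm_left fun i k l => doubleBracket c k i l * (pderiv i a * pderiv k b * pderiv l d),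
    sum_comm_right fun i k l => doubleBracket c i k l * (pderiv k a * pderiv i b * pderiv l d),
    sum_comm_left fun i k l => doubleBracket c i l k * (pderiv l a * pderiv i b * pderiv k d),
    sum_comm_right fun i k l => doubleBracket c k l i * (pderiv l a * pderiv k b * pderiv i d)]
  simp only [phiLinear, Finset.mul_sum, Finset.sum_mul, ← Finset.sum_add_distrib,
    ← Finset.sum_sub_distrib]
  refine Finset.sum_congr rfl fun i _ => Finset.sum_congr rfl fun j _ =>
    Finset.sum_congr rfl fun k _ => ?_
  rw [pderiv_pderiv_mul, pderiv_pderiv_mul, pderiv_mul_eq, pderiv_mul_eq]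
  ring

lemma Pb_Pb_right_reversed (hskew : ∀ k i j, c k i j = - c k j i)
    (a b d : MvPolynomial (Fin n) ℂ) :
    Pb c d (Pb c b a) =
      (∑ i, ∑ k, ∑ l, doubleBracket c l k i * (pderiv i a * pderiv k b * pderiv l d)) +
      ∑ i, ∑ j, ∑ k, ∑ l, poissonTensor c i j * poissonTensor c k l *
        (pderiv l d * (pderiv j (pderiv k b) * pderiv i a + pderiv j b * pderiv i (pderiv k a))) := by
  rw [Pb_Pb_right, sum_reverse]
  refine congrArg₂ (· + ·) ?_ ?_
  · rw [sum_comm_left, sum_comm_right, sum_comm_left]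
    refine Finset.sum_congr rfl fun i _ => Finset.sum_congr rfl fun j _ =>
      Finset.sum_congr rfl fun k _ => ?_
    ring
  · refine Finset.sum_congr rfl fun i _ => Finset.sum_congr rfl fun j _ =>
      Finset.sum_congr rfl fun k _ => Finset.sum_congr rfl fun l _ => ?_
    rw [poissonTensor_skew c hskew l k, poissonTensor_skew c hskew j i, pderiv_comm k j,
      pderiv_comm k i]
    ring

lemma Pb_associator (hskew : ∀ k i j, c k i j = - c k j i)
    (hjac : ∀ i j l m, (∑ k, (c k i j * c m k l + c k j l * c m k i + c k l i * c m k j)) = 0)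
    (a b d : MvPolynomial (Fin n) ℂ) :
    Pb c a (Pb c b d) - Pb c (Pb c a b) d =
      - coboundaryQuadratic c a b d - coboundaryLinear c a b d := by
  have h₁ : (∑ i, ∑ k, ∑ l, doubleBracket c i k l * (pderiv i a * pderiv k b * pderiv l d)) -
      (∑ i, ∑ k, ∑ l, doubleBracket c l k i * (pderiv i a * pderiv k b * pderiv l d)) +
      (∑ i, ∑ k, ∑ l, doubleBracket c k l i * (pderiv i a * pderiv k b * pderiv l d)) = 0 := by
    simp only [← Finset.sum_add_distrib, ← Finset.sum_sub_distrib]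
    refine Finset.sum_eq_zero fun i _ => Finset.sum_eq_zero fun k _ =>
      Finset.sum_eq_zero fun l _ => ?_
    linear_combination (pderiv i a * pderiv k b * pderiv l d) *
      (doubleBracket_jacobi c hskew hjac i k l - doubleBracket_skew c hskew l i k)
  have h₂ : (∑ i, ∑ j, ∑ k, ∑ l, poissonTensor c i j * poissonTensor c k l *
        (pderiv i a * (pderiv j (pderiv k b) * pderiv l d + pderiv k b * pderiv j (pderiv l d)))) -
      (∑ i, ∑ j, ∑ k, ∑ l, poissonTensor c i j * poissonTensor c k l *
        (pderiv l d * (pderiv j (pderiv k b) * pderiv i a +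
          pderiv j b * pderiv i (pderiv k a)))) +
      (∑ i, ∑ j, ∑ k, ∑ l, poissonTensor c i j * poissonTensor c k l *
        (pderiv i (pderiv k a) * pderiv j b * pderiv l d -
          pderiv i a * pderiv k b * pderiv j (pderiv l d))) = 0 := by
    simp only [← Finset.sum_add_distrib, ← Finset.sum_sub_distrib]
    refine Finset.sum_eq_zero fun i _ => Finset.sum_eq_zero fun j _ =>
      Finset.sum_eq_zero fun k _ => Finset.sum_eq_zero fun l _ => ?_
    ring
  rw [Pb_Pb_left c hskew, Pb_Pb_right_reversed c hskew a b d, Pb_Pb_right c a b d,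
    coboundaryQuadratic, coboundaryLinear]
  linear_combination h₁ + h₂

lemma phiL_coboundary (hskew : ∀ k i j, c k i j = - c k j i)
    (hjac : ∀ i j l m, (∑ k, (c k i j * c m k l + c k j l * c m k i + c k l i * c m k j)) = 0)
    (a b d : MvPolynomial (Fin n) ℂ) :
    Pb c a (Pb c b d) - Pb c (Pb c a b) d
      + a * phiL c b d - phiL c (a * b) d + phiL c a (b * d) - phiL c a b * d = 0 := by
  have h2 : C (2 : ℂ)⁻¹ * 2 = (1 : MvPolynomial (Fin n) ℂ) := by
    rw [← map_ofNat C 2, ← C_mul]; norm_num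
  have h3 : C (3 : ℂ)⁻¹ * 3 = (1 : MvPolynomial (Fin n) ℂ) := by
    rw [← map_ofNat C 3, ← C_mul]; norm_num
  simp only [phiL_apply]
  linear_combination Pb_associator c hskew hjac a b d +
    C (2 : ℂ)⁻¹ * phiQuadratic_coboundary c a b d +
    C (3 : ℂ)⁻¹ * phiLinear_coboundary c hskew hjac a b d +
    coboundaryQuadratic c a b d * h2 + coboundaryLinear c a b d * h3

end

/-- `P ∘ P + d_H Φ = 0`, i.e. `P ∘ P` is a Hochschild 3-coboundary, so `P`
is a Poisson bracket on the noncommutative algebra `End V ⊗ S(𝔤)` in the sense of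
Block–Getzler. -/
theorem stmt6 {n : ℕ} (c : Fin n → Fin n → Fin n → ℂ)
    {V : Type*} [AddCommGroup V] [Module ℂ V]
    (hskew : ∀ k i j, c k i j = - c k j i)
    (hjac : ∀ i j l m, (∑ k, (c k i j * c m k l + c k j l * c m k i + c k l i * c m k j)) = 0)
    (𝒜 ℬ 𝒞 : Module.End ℂ V ⊗[ℂ] MvPolynomial (Fin n) ℂ) :
    Pnc c V 𝒜 (Pnc c V ℬ 𝒞) - Pnc c V (Pnc c V 𝒜 ℬ) 𝒞
      + 𝒜 * PhiNc c V ℬ 𝒞 - PhiNc c V (𝒜 * ℬ) 𝒞 + PhiNc c V 𝒜 (ℬ * 𝒞)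
      - PhiNc c V 𝒜 ℬ * 𝒞 = 0 := by
  have hP (A B : Module.End ℂ V) (a b : MvPolynomial (Fin n) ℂ) :
      Pnc c V (A ⊗ₜ a) (B ⊗ₜ b) = (A * B) ⊗ₜ Pb c a b := rfl
  have hΦ (A B : Module.End ℂ V) (a b : MvPolynomial (Fin n) ℂ) :
      PhiNc c V (A ⊗ₜ a) (B ⊗ₜ b) = (A * B) ⊗ₜ phiL c a b := rfl
  induction 𝒜 using TensorProduct.induction_on with
  | zero => simp
  | add x y hx hy =>
    simp only [add_mul, map_add, LinearMap.add_apply]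
    linear_combination (norm := abel) hx + hy
  | tmul A a =>
    induction ℬ using TensorProduct.induction_on with
    | zero => simp
    | add x y hx hy =>
      simp only [add_mul, mul_add, map_add, LinearMap.add_apply]
      linear_combination (norm := abel) hx + hy
    | tmul B b =>
      induction 𝒞 using TensorProduct.induction_on with
      | zero => simp
      | add x y hx hy =>
        simp only [mul_add, map_add]
        linear_combination (norm := abel) hx + hy
      | tmul D d =>
        simp only [hP, hΦ, Algebra.TensorProduct.tmul_mul_tmul, mul_assoc, ← tmul_add, ← tmul_sub]
        rw [phiL_coboundary c hskew hjac, tmul_zero]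

end
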